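/- arXiv:1210.0278 — 2 statements merged into one kernel-verified Lean document; each statement's English description precedes it below -/
import Mathlib

section
/- Let q₁, q₂ ∈ ℝ³ with ‖q₁‖ = ‖q₂‖ = 1, q₁ ∈ {e₃, −e₃} and q₂ ∉ {e₃, −e₃} (exactly the first pendulum vertical), and let f : ℝ³ → ℝ be differentiable at ι = ι(q₁,q₂) with partial derivatives ∂ⱼf(ι) = (fderiv f ι)(eⱼ). Then (q₁,q₂) is a critical point of f ∘ ι restricted to S² × S² if and only if ∂₂f(ι) = 0 and ∂₃f(ι) = 0. -/
noncomputable section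

/-- Standard dot product on ℝ³. -/
def dot (x y : Fin 3 → ℝ) : ℝ := ∑ i, x i * y i

/-- Third standard basis vector of ℝ³. -/
def e3 : Fin 3 → ℝ := ![0, 0, 1]

/-- Orthogonal projection onto the horizontal plane. -/
def P3 (v : Fin 3 → ℝ) : Fin 3 → ℝ := v - dot e3 v • e3

/-- The invariant map `ι(q₁,q₂) = (⟨e₃,q₁⟩, ⟨e₃,q₂⟩, ⟨q₁, P₃ q₂⟩)`. -/
def iota (q : (Fin 3 → ℝ) × (Fin 3 → ℝ)) : Fin 3 → ℝ :=
  ![dot e3 q.1, dot e3 q.2, dot q.1 (P3 q.2)]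

/-- `q` is a critical point of `F` restricted to `S² × S²`: `F` is differentiable at `q`
and its differential vanishes on all tangent vectors to the product of spheres. -/
def IsCritPt (F : (Fin 3 → ℝ) × (Fin 3 → ℝ) → ℝ) (q : (Fin 3 → ℝ) × (Fin 3 → ℝ)) : Prop :=
  DifferentiableAt ℝ F q ∧
    ∀ v₁ v₂ : Fin 3 → ℝ, dot q.1 v₁ = 0 → dot q.2 v₂ = 0 → fderiv ℝ F q (v₁, v₂) = 0

lemma iota_eq (q : (Fin 3 → ℝ) × (Fin 3 → ℝ)) :
    iota q = ![q.1 2, q.2 2, q.1 0 * q.2 0 + q.1 1 * q.2 1] := by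
  simp [iota, dot, P3, e3, Fin.sum_univ_three]

lemma differentiable_iota : Differentiable ℝ iota := by
  rw [funext iota_eq]
  refine differentiable_pi.2 fun i => ?_
  fin_cases i <;> simp <;> fun_prop

/-- The directional derivative of the invariant map. -/
lemma fderiv_iota_apply (q v : (Fin 3 → ℝ) × (Fin 3 → ℝ)) :
    fderiv ℝ iota q v = ![v.1 2, v.2 2,
      v.1 0 * q.2 0 + q.1 0 * v.2 0 + (v.1 1 * q.2 1 + q.1 1 * v.2 1)] := by
  have hl : HasDerivAt (fun t : ℝ => q + t • v) v 0 := by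
    simpa using ((hasDerivAt_id (0 : ℝ)).smul_const v).const_add q
  have hi : HasDerivAt (fun t : ℝ => iota (q + t • v)) (fderiv ℝ iota q v) 0 := by
    have hd := (differentiable_iota (q + (0 : ℝ) • v)).hasFDerivAt.comp_hasDerivAt 0 hl
    simpa [Function.comp_def] using hd
  have hc (a b : ℝ) : HasDerivAt (fun t : ℝ => a + t * b) b 0 := by
    simpa using ((hasDerivAt_id (0 : ℝ)).mul_const b).const_add a
  refine hi.unique (hasDerivAt_pi.2 fun i => ?_)
  simp only [iota_eq]
  fin_cases i
  · simpa using hc (q.1 2) (v.1 2)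
  · simpa using hc (q.2 2) (v.2 2)
  · simpa [Pi.add_def, Pi.mul_def] using ((hc (q.1 0) (v.1 0)).mul (hc (q.2 0) (v.2 0))).add
      ((hc (q.1 1) (v.1 1)).mul (hc (q.2 1) (v.2 1)))

lemma clm_apply_eq_sum (L : (Fin 3 → ℝ) →L[ℝ] ℝ) (a b c : ℝ) :
    L ![a, b, c] = a * L (Pi.single 0 1) + b * L (Pi.single 1 1) + c * L (Pi.single 2 1) := by
  have h : ![a, b, c] =
      a • (Pi.single 0 1 : Fin 3 → ℝ) + b • Pi.single 1 1 + c • Pi.single 2 1 := by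
    ext i
    fin_cases i <;> simp
  simp only [h, map_add, map_smul, smul_eq_mul]

/-- The only unit vectors with third coordinate of absolute value one are `±e₃`. -/
lemma eq_e3_or_eq_neg_e3 {q : Fin 3 → ℝ} (hq : dot q q = 1) (hz : q 2 * q 2 = 1) :
    q = e3 ∨ q = -e3 := by
  simp only [dot, Fin.sum_univ_three] at hq
  have hx : q 0 = 0 := by nlinarith [sq_nonneg (q 0), sq_nonneg (q 1)]
  have hy : q 1 = 0 := by nlinarith [sq_nonneg (q 0), sq_nonneg (q 1)]
  refine (mul_self_eq_one_iff.1 hz).imp (fun h => ?_) fun h => ?_ <;>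
    · ext i
      fin_cases i <;> simp [e3, hx, hy, h]

/-- If exactly the first pendulum is vertical, `(q₁,q₂)` is a critical point of
`f ∘ ι` on `S² × S²` iff `∂₂f(ι) = 0` and `∂₃f(ι) = 0`. -/
theorem stmt7 (q₁ q₂ : Fin 3 → ℝ) (h₁ : dot q₁ q₁ = 1) (h₂ : dot q₂ q₂ = 1)
    (hv₁ : q₁ = e3 ∨ q₁ = -e3) (hv₂ : q₂ ≠ e3 ∧ q₂ ≠ -e3)
    (f : (Fin 3 → ℝ) → ℝ) (hf : DifferentiableAt ℝ f (iota (q₁, q₂))) :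
    IsCritPt (fun q => f (iota q)) (q₁, q₂) ↔
      (fderiv ℝ f (iota (q₁, q₂)) (Pi.single 1 1) = 0
        ∧ fderiv ℝ f (iota (q₁, q₂)) (Pi.single 2 1) = 0) := by
  have hz : 1 - q₂ 2 * q₂ 2 ≠ 0 := fun h =>
    (eq_e3_or_eq_neg_e3 h₂ (by linarith)).elim hv₂.1 hv₂.2
  have hxy : q₂ 0 * q₂ 0 + q₂ 1 * q₂ 1 = 1 - q₂ 2 * q₂ 2 := by
    simp only [dot, Fin.sum_univ_three] at h₂
    linarith
  have h0 : q₁ 0 = 0 := by rcases hv₁ with rfl | rfl <;> simp [e3]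
  have h1 : q₁ 1 = 0 := by rcases hv₁ with rfl | rfl <;> simp [e3]
  have hq : q₁ 2 ≠ 0 := by rcases hv₁ with rfl | rfl <;> simp [e3]
  have hF := hf.hasFDerivAt.comp (q₁, q₂) (differentiable_iota (q₁, q₂)).hasFDerivAt
  have hd (v₁ v₂ : Fin 3 → ℝ) : fderiv ℝ (fun q => f (iota q)) (q₁, q₂) (v₁, v₂) =
      v₁ 2 * fderiv ℝ f (iota (q₁, q₂)) (Pi.single 0 1)
        + v₂ 2 * fderiv ℝ f (iota (q₁, q₂)) (Pi.single 1 1)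
        + (v₁ 0 * q₂ 0 + v₁ 1 * q₂ 1) * fderiv ℝ f (iota (q₁, q₂)) (Pi.single 2 1) := by
    have hF' : HasFDerivAt (fun q => f (iota q)) _ (q₁, q₂) := hF
    rw [hF'.fderiv, ContinuousLinearMap.comp_apply, fderiv_iota_apply, clm_apply_eq_sum]
    simp [h0, h1]
  constructor
  · rintro ⟨-, h⟩
    constructor
    · have h' := h 0 ![-(q₂ 2 * q₂ 0), -(q₂ 2 * q₂ 1), 1 - q₂ 2 * q₂ 2] (by simp [dot]) (by
        simp only [dot, Fin.sum_univ_three]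
        simp
        linear_combination -q₂ 2 * hxy)
      rw [hd] at h'
      simpa [hz] using h'
    · have h' := h ![q₂ 0, q₂ 1, 0] 0 (by simp [dot, Fin.sum_univ_three, h0, h1]) (by simp [dot])
      rw [hd] at h'
      simpa [hxy, hz] using h'
  · rintro ⟨h2, h3⟩
    refine ⟨hF.differentiableAt, fun v₁ v₂ hv _ => ?_⟩
    have hv0 : v₁ 2 = 0 := by simpa [dot, Fin.sum_univ_three, h0, h1, hq] using hv
    rw [hd, h2, h3, hv0]
    simp
end
end

section
/- Define C(A, η, ζ) = ⟨η × (A·Aᵀ·η), A·ζ⟩ + ⟨ζ × (Aᵀ·A·ζ), Aᵀ·η⟩ for a real 3×3 matrix A and η, ζ ∈ ℝ³. If D is a diagonal real 3×3 matrix and η, ζ ∈ ℝ³ satisfy ηⱼ = ζⱼ = 0 for some common index j ∈ {1,2,3}, then C(D, η, ζ) = 0. Consequently, every coplanar point (A, η, ζ) — i.e. one of the form A = U·D·Vᵀ, η' = U·η, ζ' = V·ζ with U, V ∈ SO(3), D diagonal, and ηⱼ = ζⱼ = 0 for some j — is a zero of C. -/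
open Matrix

/-- The invariant `C(A,η,ζ) = ⟨η × (AAᵀη), Aζ⟩ + ⟨ζ × (AᵀAζ), Aᵀη⟩`. -/
def Cfun (A : Matrix (Fin 3) (Fin 3) ℝ) (η ζ : Fin 3 → ℝ) : ℝ :=
  dot (crossProduct η ((A * Aᵀ).mulVec η)) (A.mulVec ζ)
    + dot (crossProduct ζ ((Aᵀ * A).mulVec ζ)) (Aᵀ.mulVec η)

theorem dot_crossProduct_mulVec (U : Matrix (Fin 3) (Fin 3) ℝ) (a b c : Fin 3 → ℝ) :
    dot (crossProduct (U.mulVec a) (U.mulVec b)) (U.mulVec c) =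
      U.det * dot (crossProduct a b) c := by
  simp only [dot, Fin.sum_univ_three, cross_apply, det_fin_three, mulVec, dotProduct,
    cons_val_zero, cons_val_one, cons_val]
  ring

theorem Cfun_mul_mul_transpose (A U V : Matrix (Fin 3) (Fin 3) ℝ) (η ζ : Fin 3 → ℝ)
    (hU : Uᵀ * U = 1) (hUdet : U.det = 1) (hV : Vᵀ * V = 1) (hVdet : V.det = 1) :
    Cfun (U * A * Vᵀ) (U.mulVec η) (V.mulVec ζ) = Cfun A η ζ := by
  have cancelU (M : Matrix (Fin 3) (Fin 3) ℝ) : Uᵀ * (U * M) = M := by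
    rw [← Matrix.mul_assoc, hU, Matrix.one_mul]
  have cancelV (M : Matrix (Fin 3) (Fin 3) ℝ) : Vᵀ * (V * M) = M := by
    rw [← Matrix.mul_assoc, hV, Matrix.one_mul]
  have h₁ : (U * A * Vᵀ * (U * A * Vᵀ)ᵀ).mulVec (U.mulVec η) =
      U.mulVec ((A * Aᵀ).mulVec η) := by
    simp only [mulVec_mulVec, transpose_mul, transpose_transpose, Matrix.mul_assoc, cancelV,
      hU, Matrix.mul_one]
  have h₂ : ((U * A * Vᵀ)ᵀ * (U * A * Vᵀ)).mulVec (V.mulVec ζ) =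
      V.mulVec ((Aᵀ * A).mulVec ζ) := by
    simp only [mulVec_mulVec, transpose_mul, transpose_transpose, Matrix.mul_assoc, cancelU,
      hV, Matrix.mul_one]
  have h₃ : (U * A * Vᵀ).mulVec (V.mulVec ζ) = U.mulVec (A.mulVec ζ) := by
    simp only [mulVec_mulVec, Matrix.mul_assoc, hV, Matrix.mul_one]
  have h₄ : (U * A * Vᵀ)ᵀ.mulVec (U.mulVec η) = V.mulVec (Aᵀ.mulVec η) := by
    simp only [mulVec_mulVec, transpose_mul, transpose_transpose, Matrix.mul_assoc, hU,
      Matrix.mul_one]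
  rw [Cfun, h₁, h₂, h₃, h₄, dot_crossProduct_mulVec, dot_crossProduct_mulVec, hUdet, hVdet,
    one_mul, one_mul, Cfun]

theorem Cfun_diagonal_eq_zero (d η ζ : Fin 3 → ℝ) (j : Fin 3) (hη : η j = 0) (hζ : ζ j = 0) :
    Cfun (diagonal d) η ζ = 0 := by
  simp only [Cfun, dot, Fin.sum_univ_three, cross_apply, diagonal_transpose,
    diagonal_mul_diagonal, mulVec_diagonal, cons_val_zero, cons_val_one, cons_val]
  fin_cases j <;> simp only [Fin.zero_eta, Fin.mk_one, Fin.reduceFinMk] at hη hζ <;>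
    rw [hη, hζ] <;> ring

/-- `C` vanishes at coplanar points: if `D` is diagonal and `η, ζ` both lie in the
coordinate plane orthogonal to `eⱼ`, then `C(D,η,ζ) = 0`, and consequently every
coplanar point `(UDVᵀ, Uη, Vζ)` with `U, V ∈ SO(3)` is a zero of `C`. -/
theorem stmt17 (D : Matrix (Fin 3) (Fin 3) ℝ) (hD : D.IsDiag)
    (η ζ : Fin 3 → ℝ) (j : Fin 3) (hη : η j = 0) (hζ : ζ j = 0) :
    Cfun D η ζ = 0 ∧
      ∀ U V : Matrix (Fin 3) (Fin 3) ℝ,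
        Uᵀ * U = 1 → U.det = 1 → Vᵀ * V = 1 → V.det = 1 →
        Cfun (U * D * Vᵀ) (U.mulVec η) (V.mulVec ζ) = 0 := by
  have h : Cfun D η ζ = 0 := by
    rw [← hD.diagonal_diag]
    exact Cfun_diagonal_eq_zero _ η ζ j hη hζ
  exact ⟨h, fun U V hU hUdet hV hVdet =>
    (Cfun_mul_mul_transpose D U V η ζ hU hUdet hV hVdet).trans h⟩
end
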